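/- Sign recursion under adding an uncontracted top connector (equation (eq:sgnpi+pi+2) in the proof of Lemma 3.4): let m ∈ ℕ, n ≥ 1, and let (π, π') be a contraction configuration of size C for (m, n−1), i.e. π : {1,…,C} → {1,…,n−1} is strictly decreasing and π' : {1,…,C} → {1,…,m} is injective. Then (π, π') is also a contraction configuration of size C for (m, n) (π avoids the value n), and sgn(π, π', m, n) = (−1)^m · sgn(π, π', m, n−1). -/

import Mathlib

open scoped Classical

noncomputable section

/-- The unique permutation `σ` of `Fin n` taking the contraction `π` into maximally
crossed form: `σ (π c)` has value `n − 1 − c` (i.e. `σ` sends the `c`-th contracted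
connector to the `c`-th top-most position), and `σ` is strictly increasing on the
complement of the range of `π`.  (Defined by choice; for injective `π` such a
permutation exists and is unique.) -/
def maxCrossPerm {n C : ℕ} (π : Fin C → Fin n) : Equiv.Perm (Fin n) :=
  if h : ∃ σ : Equiv.Perm (Fin n),
      (∀ c : Fin C, ((σ (π c) : Fin n) : ℕ) = n - 1 - (c : ℕ)) ∧
      ∀ u₁ u₂ : Fin n, u₁ ∉ Set.range π → u₂ ∉ Set.range π → u₁ < u₂ → σ u₁ < σ u₂
  then h.choose else 1

/-- The sign `sgn(π, π', m, n) = (−1)^{(m−C)(n−C)} · sign σ · sign σ'` of a contraction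
configuration. -/
def configSign {m n C : ℕ} (π : Fin C → Fin n) (π' : Fin C → Fin m) : ℤ :=
  (-1) ^ ((m - C) * (n - C)) *
    ((Equiv.Perm.sign (maxCrossPerm π) : ℤˣ) : ℤ) *
    ((Equiv.Perm.sign (maxCrossPerm π') : ℤˣ) : ℤ)


/-- `σ` takes the contraction `π` into maximally crossed form. -/
def IsMaxCross {n C : ℕ} (π : Fin C → Fin n) (σ : Equiv.Perm (Fin n)) : Prop :=
  (∀ c : Fin C, ((σ (π c) : Fin n) : ℕ) = n - 1 - (c : ℕ)) ∧
    ∀ u₁ u₂ : Fin n, u₁ ∉ Set.range π → u₂ ∉ Set.range π → u₁ < u₂ → σ u₁ < σ u₂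

theorem le_of_injective_fin {n C : ℕ} {π : Fin C → Fin n} (hπ : Function.Injective π) :
    C ≤ n := by
  simpa using Fintype.card_le_of_injective π hπ

/-- A permutation of `Fin n` fixing all `j ≥ k` and strictly increasing below `k` is trivial. -/
theorem Equiv.Perm.eq_one_of_fixes_ge_of_strictMono_lt {n : ℕ} (k : ℕ) (ρ : Equiv.Perm (Fin n))
    (hfix : ∀ j : Fin n, k ≤ (j : ℕ) → ρ j = j)
    (hmono : ∀ i j : Fin n, (i : ℕ) < k → (j : ℕ) < k → i < j → ρ i < ρ j) : ρ = 1 := by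
  have hlow : ∀ i : Fin n, (i : ℕ) < k → (ρ i : ℕ) < k := by
    intro i hi
    by_contra! h
    have : ρ i = i := ρ.injective (hfix _ h)
    rw [this] at h
    omega
  have hρ : StrictMono ρ := by
    intro i j hij
    by_cases hj : (j : ℕ) < k
    · exact hmono i j (lt_trans hij hj) hj hij
    · rw [hfix j (not_lt.1 hj)]
      by_cases hi : (i : ℕ) < k
      · exact Fin.lt_def.2 (lt_of_lt_of_le (hlow i hi) (not_lt.1 hj))
      · rwa [hfix i (not_lt.1 hi)]
  have h : hρ.orderIsoOfSurjective ρ ρ.surjective = OrderIso.refl _ := Subsingleton.elim _ _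
  ext i
  exact congrArg Fin.val (DFunLike.congr_fun h i)

theorem IsMaxCross.unique {n C : ℕ} {π : Fin C → Fin n} (hC : C ≤ n) {σ τ : Equiv.Perm (Fin n)}
    (hσ : IsMaxCross π σ) (hτ : IsMaxCross π τ) : σ = τ := by
  suffices h : σ.symm.trans τ = 1 by
    ext u
    simpa using congrArg Fin.val (DFunLike.congr_fun h (σ u)).symm
  have hout : ∀ j : Fin n, (j : ℕ) < n - C → σ.symm j ∉ Set.range π := by
    rintro j hj ⟨c, hc⟩
    have h := hσ.1 c
    rw [hc, Equiv.apply_symm_apply] at h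
    omega
  refine Equiv.Perm.eq_one_of_fixes_ge_of_strictMono_lt (n - C) _ (fun j hj => ?_)
    fun i j hi hj hij => ?_
  · have hc := hσ.1 ⟨n - 1 - j, by omega⟩
    have hj' : σ (π ⟨n - 1 - j, by omega⟩) = j := by
      ext
      rw [hc]
      simp only
      omega
    have hc' := hτ.1 ⟨n - 1 - j, by omega⟩
    rw [Equiv.trans_apply, ← σ.eq_symm_apply.2 hj']
    ext
    rw [hc']
    simp only
    omega
  · refine hτ.2 _ _ (hout i hi) (hout j hj) ?_
    rcases lt_trichotomy (σ.symm i) (σ.symm j) with h | h | h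
    · exact h
    · exact absurd (σ.symm.injective h) hij.ne
    · have := hσ.2 _ _ (hout j hj) (hout i hi) h
      simp only [Equiv.apply_symm_apply] at this
      exact absurd this hij.not_gt

theorem exists_isMaxCross {n C : ℕ} {π : Fin C → Fin n} (hπ : Function.Injective π) :
    ∃ σ : Equiv.Perm (Fin n), IsMaxCross π σ := by
  have hC := le_of_injective_fin hπ
  set s : Finset (Fin n) := (Finset.univ.image π)ᶜ with hs
  have hcard : s.card = n - C := by
    rw [hs, Finset.card_compl, Finset.card_image_of_injective _ hπ]
    simp
  have hmem : ∀ u, u ∉ Set.range π → u ∈ s := fun u hu => by simpa [hs] using hu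
  let e := s.orderIsoOfFin hcard
  let g : Fin n → Fin n := fun u =>
    if h : u ∈ Set.range π then ⟨n - 1 - (h.choose : ℕ), by have := u.2; omega⟩
    else ⟨e.symm ⟨u, hmem u h⟩, by have := (e.symm ⟨u, hmem u h⟩).2; omega⟩
  have hg₁ : ∀ c, (g (π c) : ℕ) = n - 1 - c := by
    intro c
    have h : π c ∈ Set.range π := ⟨c, rfl⟩
    have : h.choose = c := hπ h.choose_spec
    simp only [g, dif_pos h, this]
  have hg₂ : ∀ u (h : u ∉ Set.range π), (g u : ℕ) = e.symm ⟨u, hmem u h⟩ := by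
    intro u h
    simp only [g, dif_neg h]
  have hne : ∀ c u, u ∉ Set.range π → g (π c) ≠ g u := by
    intro c u hu h
    have h' := congrArg Fin.val h
    rw [hg₁, hg₂ u hu] at h'
    have := (e.symm ⟨u, hmem u hu⟩).2
    have := c.2
    omega
  have hg : Function.Injective g := by
    intro u v huv
    by_cases hu : u ∈ Set.range π <;> by_cases hv : v ∈ Set.range π
    · obtain ⟨c, rfl⟩ := hu
      obtain ⟨d, rfl⟩ := hv
      have h' := congrArg Fin.val huv
      rw [hg₁, hg₁] at h'
      congr 1
      ext
      omega
    · obtain ⟨c, rfl⟩ := hu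
      exact absurd huv (hne c v hv)
    · obtain ⟨d, rfl⟩ := hv
      exact absurd huv.symm (hne d u hu)
    · have h' := congrArg Fin.val huv
      rw [hg₂ u hu, hg₂ v hv] at h'
      exact congrArg Subtype.val (e.symm.injective (Fin.ext h'))
  refine ⟨Equiv.ofBijective g (Finite.injective_iff_bijective.1 hg), hg₁, fun u v hu hv huv => ?_⟩
  rw [Equiv.ofBijective_apply, Equiv.ofBijective_apply, Fin.lt_def, hg₂ u hu, hg₂ v hv]
  exact Fin.lt_def.1 (e.symm.lt_iff_lt.2 huv)

theorem IsMaxCross.maxCrossPerm_eq {n C : ℕ} {π : Fin C → Fin n} (hC : C ≤ n)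
    {σ : Equiv.Perm (Fin n)} (hσ : IsMaxCross π σ) : maxCrossPerm π = σ := by
  have h : ∃ σ, IsMaxCross π σ := ⟨σ, hσ⟩
  have h' : maxCrossPerm π = h.choose := dif_pos h
  rw [h']
  exact h.choose_spec.unique hC hσ

/-- Adding an uncontracted top connector extends `σ` by a fixed top value and then moves that
value down to position `n - C`. -/
theorem IsMaxCross.castSucc {n C : ℕ} {π : Fin C → Fin n} (hC : C ≤ n)
    {σ : Equiv.Perm (Fin n)} (hσ : IsMaxCross π σ) :
    IsMaxCross (fun c => (π c).castSucc)
      (Fin.cycleIcc ⟨n - C, by omega⟩ (Fin.last n) *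
        σ.viaFintypeEmbedding Fin.castSuccEmb) := by
  set k : Fin (n + 1) := ⟨n - C, by omega⟩
  set τ := Fin.cycleIcc k (Fin.last n) * σ.viaFintypeEmbedding Fin.castSuccEmb with hτ
  have hcast : ∀ u : Fin n, τ u.castSucc = k.succAbove (σ u) := by
    intro u
    have h₁ : σ.viaFintypeEmbedding Fin.castSuccEmb u.castSucc = (σ u).castSucc :=
      σ.viaFintypeEmbedding_apply_image Fin.castSuccEmb u
    have h₂ := congrFun (Fin.cycleIcc_comp_succAbove k (Fin.last n) (Fin.le_last k)) (σ u)
    simp only [Function.comp_apply, Fin.succAbove_last] at h₂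
    rw [hτ, Equiv.Perm.mul_apply, h₁, h₂]
  have hlast : τ (Fin.last n) = k := by
    have h₁ : σ.viaFintypeEmbedding Fin.castSuccEmb (Fin.last n) = Fin.last n := by
      apply Equiv.Perm.viaFintypeEmbedding_apply_notMem_range
      rintro ⟨u, hu⟩
      exact (Fin.castSucc_lt_last u).ne hu
    rw [hτ, Equiv.Perm.mul_apply, h₁, Fin.cycleIcc_of_last (Fin.le_last k)]
  have hlow : ∀ u, u ∉ Set.range π → (σ u : ℕ) < n - C := by
    intro u hu
    by_contra! h
    have hc := hσ.1 ⟨n - 1 - σ u, by omega⟩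
    refine hu ⟨⟨n - 1 - σ u, by omega⟩, σ.injective (Fin.ext ?_)⟩
    rw [hc]
    simp only
    omega
  refine ⟨fun c => ?_, fun u v hu hv huv => ?_⟩
  · have hc := hσ.1 c
    have := c.2
    rw [hcast, Fin.succAbove_of_le_castSucc _ _ (by
      rw [Fin.le_def, Fin.val_castSucc]; simp only [k]; omega), Fin.val_succ, hc]
    omega
  · induction u using Fin.lastCases with
    | last => exact absurd huv (Fin.le_last v).not_gt
    | cast u =>
      have hu' : u ∉ Set.range π := fun ⟨c, hc⟩ => hu ⟨c, congrArg Fin.castSucc hc⟩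
      induction v using Fin.lastCases with
      | last =>
        rw [hcast, hlast, Fin.succAbove_lt_iff_castSucc_lt]
        exact hlow u hu'
      | cast v =>
        have hv' : v ∉ Set.range π := fun ⟨c, hc⟩ => hv ⟨c, congrArg Fin.castSucc hc⟩
        rw [hcast, hcast]
        exact Fin.strictMono_succAbove k (hσ.2 u v hu' hv' huv)

theorem sign_maxCrossPerm_castSucc {n C : ℕ} {π : Fin C → Fin n} (hπ : Function.Injective π) :
    Equiv.Perm.sign (maxCrossPerm fun c => (π c).castSucc) =
      (-1) ^ C * Equiv.Perm.sign (maxCrossPerm π) := by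
  have hC := le_of_injective_fin hπ
  obtain ⟨σ, hσ⟩ := exists_isMaxCross hπ
  rw [hσ.maxCrossPerm_eq hC, (hσ.castSucc hC).maxCrossPerm_eq (by omega), Equiv.Perm.sign_mul,
    Equiv.Perm.viaFintypeEmbedding_sign, Fin.sign_cycleIcc_of_le (Fin.le_last _)]
  simp only [Fin.val_last, Nat.sub_sub_self hC]

/-- **Sign recursion under adding an uncontracted top connector** (eq. (eq:sgnpi+pi+2) in
the proof of Lemma 3.4), stated for the paper's `n ≥ 1` as `n + 1`: if `(π, π')` is a
contraction configuration of size `C` for `(m, n−1)` (i.e. `π : Fin C → Fin n` strictly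
decreasing, `π' : Fin C → Fin m` injective), then, viewing `π` as mapping into
`Fin (n+1)` (it avoids the top value `n`), `(π, π')` is also a contraction configuration
of size `C` for `(m, n)`, and `sgn(π, π', m, n) = (−1)^m · sgn(π, π', m, n−1)`. -/
theorem configSign_uncontracted_top (m n C : ℕ)
    (π : Fin C → Fin n) (hπ : StrictAnti π)
    (π' : Fin C → Fin m) (hπ' : Function.Injective π') :
    StrictAnti (fun c => (π c).castSucc : Fin C → Fin (n + 1)) ∧
    configSign (fun c => (π c).castSucc : Fin C → Fin (n + 1)) π' =
      (-1) ^ m * configSign π π' := by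
  refine ⟨fun a b hab => Fin.castSucc_lt_castSucc_iff.2 (hπ hab), ?_⟩
  have hn := le_of_injective_fin hπ.injective
  have hm := le_of_injective_fin hπ'
  obtain ⟨k, rfl⟩ := Nat.exists_eq_add_of_le' hm
  obtain ⟨l, rfl⟩ := Nat.exists_eq_add_of_le' hn
  have h : l + C + 1 - C = l + 1 := by omega
  simp only [configSign, sign_maxCrossPerm_castSucc hπ.injective, h, Nat.add_sub_cancel]
  push_cast
  ring
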